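/- A split of DW⁺₄ is W₆-minor-free if and only if it is isomorphic to one of C²₇ + e, K^{3,0}_{4,3}, K^{3,1}_{4,3}, K^{4,0}_{4,3}, Γ₁, or K^{4,1}_{4,3}. -/

import Mathlib

open SimpleGraph

/-- `H` is a minor of `G`: there is a family of nonempty, pairwise disjoint,
connected branch sets in `G`, one for each vertex of `H`, such that adjacent
vertices of `H` have branch sets joined by an edge of `G`. -/
def SimpleGraph.IsMinorOf {W V : Type*} (H : SimpleGraph W) (G : SimpleGraph V) : Prop :=
  ∃ φ : W → Set V,
    (∀ w, (φ w).Nonempty) ∧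
    (∀ w, (G.induce (φ w)).Connected) ∧
    (Pairwise fun w₁ w₂ => Disjoint (φ w₁) (φ w₂)) ∧
    (∀ ⦃w₁ w₂⦄, H.Adj w₁ w₂ → ∃ a ∈ φ w₁, ∃ b ∈ φ w₂, G.Adj a b)

/-- The wheel `Wₙ`: a hub (`none`) joined to every vertex of a cycle of length `n`. -/
def wheel (n : ℕ) : SimpleGraph (Option (ZMod n)) :=
  SimpleGraph.fromRel fun a b =>
    (a = none ∧ b ≠ none) ∨ (∃ i j : ZMod n, a = some i ∧ b = some j ∧ j = i + 1)

/-- The double wheel `DWₙ`: a cycle of length `n` plus two nonadjacent hubs,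
each joined to every vertex of the cycle. -/
def doubleWheel (n : ℕ) : SimpleGraph (ZMod n ⊕ Fin 2) :=
  SimpleGraph.fromRel fun a b =>
    match a, b with
    | .inl i, .inl j => j = i + 1
    | .inl _, .inr _ => True
    | .inr _, .inl _ => True
    | .inr _, .inr _ => False

/-- `DW⁺ₙ`: the double wheel together with the edge joining the two hubs. -/
def doubleWheelPlus (n : ℕ) : SimpleGraph (ZMod n ⊕ Fin 2) :=
  SimpleGraph.fromRel fun a b =>
    match a, b with
    | .inl i, .inl j => j = i + 1
    | _, _ => True

/-- `C²₇ + e`: the square of the 7-cycle plus an edge between two (of the)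
nonadjacent vertices (all such additions give isomorphic graphs). -/
def cycleSq7PlusE : SimpleGraph (ZMod 7) :=
  SimpleGraph.fromRel fun i j => j = i + 1 ∨ j = i + 2 ∨ (i = 0 ∧ j = 3)

/-- `K^{3,0}_{4,3}`: `K_{4,3}` plus three edges forming a path on the four
vertices of the part of size four. -/
def K43_30 : SimpleGraph (Fin 4 ⊕ Fin 3) :=
  SimpleGraph.fromRel fun a b =>
    match a, b with
    | .inl _, .inr _ => True
    | .inr _, .inl _ => True
    | .inl i, .inl j => (j : ℕ) = (i : ℕ) + 1
    | .inr _, .inr _ => False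

/-- `K^{3,1}_{4,3}`: `K^{3,0}_{4,3}` plus one edge between two vertices of
the part of size three. -/
def K43_31 : SimpleGraph (Fin 4 ⊕ Fin 3) :=
  SimpleGraph.fromRel fun a b =>
    match a, b with
    | .inl _, .inr _ => True
    | .inr _, .inl _ => True
    | .inl i, .inl j => (j : ℕ) = (i : ℕ) + 1
    | .inr i, .inr j => i = 0 ∧ j = 1

/-- `K^{4,0}_{4,3}`: `K_{4,3}` plus four edges forming a cycle on the four
vertices of the part of size four. -/
def K43_40 : SimpleGraph (Fin 4 ⊕ Fin 3) :=
  SimpleGraph.fromRel fun a b =>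
    match a, b with
    | .inl _, .inr _ => True
    | .inr _, .inl _ => True
    | .inl i, .inl j => j = i + 1
    | .inr _, .inr _ => False

/-- `K^{4,1}_{4,3}`: `K^{4,0}_{4,3}` plus one edge between two vertices of
the part of size three. -/
def K43_41 : SimpleGraph (Fin 4 ⊕ Fin 3) :=
  SimpleGraph.fromRel fun a b =>
    match a, b with
    | .inl _, .inr _ => True
    | .inr _, .inl _ => True
    | .inl i, .inl j => j = i + 1
    | .inr i, .inr j => i = 0 ∧ j = 1

/-- The graph `Γ₁` of Figure 1, with vertices `0 = x`, `1 = y`, `2 = v₂`,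
`3 = v₃`, `4 = v₄`, `5 = u`, `6 = w`. -/
def Gamma1 : SimpleGraph (Fin 7) :=
  SimpleGraph.fromEdgeSet
    {s(5, 6), s(5, 2), s(5, 3), s(5, 4), s(6, 2), s(6, 3), s(6, 4),
     s(2, 3), s(3, 4), s(0, 1), s(0, 2), s(0, 4), s(0, 5), s(1, 2), s(1, 4), s(1, 6)}

/-- The split of a vertex `v` of `G` determined by `X, Y ⊆ N(v)`:
delete `v`, and add two new adjacent vertices (`inr 0` and `inr 1`) joined
to all vertices of `X` and of `Y` respectively. -/
def splitGraph {V : Type*} (G : SimpleGraph V) (v : V) (X Y : Set V) :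
    SimpleGraph ({u : V // u ≠ v} ⊕ Fin 2) :=
  SimpleGraph.fromRel fun a b =>
    match a, b with
    | .inl u, .inl u' => G.Adj u u'
    | .inl u, .inr i => (i = 0 ∧ (u : V) ∈ X) ∨ (i = 1 ∧ (u : V) ∈ Y)
    | .inr _, .inl _ => False
    | .inr _, .inr _ => True

/-- The side conditions on the data of a split of a vertex `v`:
`X, Y ⊆ N(v)`, `X ∪ Y = N(v)` and `|X|, |Y| ≥ 3`. -/
def IsSplitData {V : Type*} (G : SimpleGraph V) (v : V) (X Y : Set V) : Prop :=
  X ⊆ G.neighborSet v ∧ Y ⊆ G.neighborSet v ∧ X ∪ Y = G.neighborSet v ∧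
    3 ≤ X.ncard ∧ 3 ≤ Y.ncard

namespace SimpleGraph

variable {V W : Type*} {G : SimpleGraph V} {H : SimpleGraph W}

theorem nonempty_iso_of_injective [Fintype V] [Fintype W] (f : V → W)
    (hf : Function.Injective f) (hcard : Fintype.card V = Fintype.card W)
    (hadj : ∀ a b, H.Adj (f a) (f b) ↔ G.Adj a b) : Nonempty (G ≃g H) :=
  ⟨⟨Equiv.ofBijective f ((Fintype.bijective_iff_injective_and_card f).2 ⟨hf, hcard⟩),
    fun {a b} => hadj a b⟩⟩

theorem IsContained.isMinorOf (h : H ⊑ G) : H.IsMinorOf G := by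
  obtain ⟨f⟩ := h
  refine ⟨fun w => {f w}, fun w => Set.singleton_nonempty _, fun w => ?_, fun a b hab => ?_,
    fun a b hab => ⟨f a, rfl, f b, rfl, f.toHom.map_adj hab⟩⟩
  · exact ⟨.of_subsingleton⟩
  · simpa using f.injective.ne hab

/-- A minor on as many vertices as the host graph is a spanning subgraph. -/
theorem IsMinorOf.isContained_of_card_eq [Fintype V] [Fintype W] (h : H.IsMinorOf G)
    (hcard : Fintype.card W = Fintype.card V) : H ⊑ G := by
  obtain ⟨φ, hne, -, hdisj, hadj⟩ := h
  choose f hf using hne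
  have hinj : Function.Injective f := fun a b hab => by
    by_contra hne
    exact Set.disjoint_left.1 (hdisj hne) (hf a) (hab ▸ hf b)
  have hsurj := ((Fintype.bijective_iff_injective_and_card f).2 ⟨hinj, hcard⟩).2
  have heq : ∀ w, ∀ a ∈ φ w, a = f w := fun w a ha => by
    obtain ⟨w', rfl⟩ := hsurj a
    by_contra hne
    exact Set.disjoint_left.1 (hdisj fun h : w' = w => hne (h ▸ rfl)) (hf w') ha
  refine ⟨⟨⟨f, fun {a b} hab => ?_⟩, hinj⟩⟩
  obtain ⟨x, hx, y, hy, hxy⟩ := hadj hab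
  rwa [heq a x hx, heq b y hy] at hxy

end SimpleGraph

theorem exists_dominating_of_wheel_isMinorOf {V : Type*} [Fintype V] {n : ℕ} [NeZero n]
    {G : SimpleGraph V} (hcard : Fintype.card V = n + 1) (h : (wheel n).IsMinorOf G) :
    ∃ v, ∀ u ≠ v, G.Adj v u := by
  have hcard' : Fintype.card (Option (ZMod n)) = Fintype.card V := by
    rw [Fintype.card_option, ZMod.card, hcard]
  obtain ⟨f⟩ := h.isContained_of_card_eq hcard'
  refine ⟨f none, fun u hu => ?_⟩
  obtain ⟨w, rfl⟩ :=
    ((Fintype.bijective_iff_injective_and_card f).2 ⟨f.injective, hcard'⟩).2 u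
  refine f.toHom.map_adj ?_
  have hw : w ≠ none := fun h => hu (h ▸ rfl)
  simp [wheel, hw, hw.symm]

theorem wheel_isContained {V : Type*} {n : ℕ} {G : SimpleGraph V} (h : V) (c : ZMod n → V)
    (hc : Function.Injective c) (hub : ∀ i, G.Adj h (c i)) (rim : ∀ i, G.Adj (c i) (c (i + 1))) :
    wheel n ⊑ G := by
  refine ⟨⟨⟨fun w => w.elim h c, fun {a b} hab => ?_⟩, fun a b hab => ?_⟩⟩
  · obtain ⟨hne, hab⟩ := hab
    rcases a with _ | a <;> rcases b with _ | b
    · simp at hne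
    · exact hub b
    · exact (hub a).symm
    · rcases hab with hab | hab <;> simp at hab <;> subst hab
      · exact rim a
      · exact (rim b).symm
  · rcases a with _ | a <;> rcases b with _ | b
    · rfl
    · exact absurd hab (hub b).ne
    · exact absurd hab (hub a).ne'
    · exact congrArg some (hc hab)

section SplitGraph

variable {V : Type*} (G : SimpleGraph V) (v : V) (X Y : Set V)

@[simp]
theorem splitGraph_adj_inl_inl {a b : {u : V // u ≠ v}} :
    (splitGraph G v X Y).Adj (.inl a) (.inl b) ↔ G.Adj a b := by
  simp only [splitGraph, SimpleGraph.fromRel_adj, G.adj_comm b a, or_self, ne_eq, Sum.inl.injEq]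
  exact ⟨And.right, fun h => ⟨fun hab => h.ne (congrArg _ hab), h⟩⟩

@[simp]
theorem splitGraph_adj_inl_inr {a : {u : V // u ≠ v}} {i : Fin 2} :
    (splitGraph G v X Y).Adj (.inl a) (.inr i) ↔ (i = 0 ∧ (a : V) ∈ X) ∨ (i = 1 ∧ (a : V) ∈ Y) := by
  simp [splitGraph]

@[simp]
theorem splitGraph_adj_inr_inl {a : {u : V // u ≠ v}} {i : Fin 2} :
    (splitGraph G v X Y).Adj (.inr i) (.inl a) ↔ (i = 0 ∧ (a : V) ∈ X) ∨ (i = 1 ∧ (a : V) ∈ Y) := by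
  simp [splitGraph]

@[simp]
theorem splitGraph_adj_inr_inr {i j : Fin 2} :
    (splitGraph G v X Y).Adj (.inr i) (.inr j) ↔ i ≠ j := by
  simp [splitGraph]

instance [DecidableRel G.Adj] [DecidablePred (· ∈ X)] [DecidablePred (· ∈ Y)] :
    DecidableRel (splitGraph G v X Y).Adj
  | .inl _, .inl _ => decidable_of_iff' _ (splitGraph_adj_inl_inl G v X Y)
  | .inl _, .inr _ => decidable_of_iff' _ (splitGraph_adj_inl_inr G v X Y)
  | .inr _, .inl _ => decidable_of_iff' _ (splitGraph_adj_inr_inl G v X Y)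
  | .inr _, .inr _ => decidable_of_iff' _ (splitGraph_adj_inr_inr G v X Y)

/-- Interchanging the two sets of a split interchanges the two new vertices. -/
def splitGraphSwap : splitGraph G v X Y ≃g splitGraph G v Y X where
  toEquiv := Equiv.sumCongr (Equiv.refl _) (Equiv.swap 0 1)
  map_rel_iff' {a b} := by
    rcases a with a | i <;> rcases b with b | j
    · simp
    · fin_cases j <;> simp
    · fin_cases i <;> simp
    · simp

end SplitGraph

/-- The graph is one of the six exceptional splits of `DW⁺₄`. -/
def IsExceptional {V : Type*} (G : SimpleGraph V) : Prop :=
  Nonempty (G ≃g cycleSq7PlusE) ∨ Nonempty (G ≃g K43_30) ∨ Nonempty (G ≃g K43_31) ∨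
    Nonempty (G ≃g K43_40) ∨ Nonempty (G ≃g Gamma1) ∨ Nonempty (G ≃g K43_41)

theorem IsExceptional.congr {V W : Type*} {G : SimpleGraph V} {H : SimpleGraph W} (e : G ≃g H)
    (h : IsExceptional H) : IsExceptional G := by
  rcases h with ⟨⟨f⟩⟩ | ⟨⟨f⟩⟩ | ⟨⟨f⟩⟩ | ⟨⟨f⟩⟩ | ⟨⟨f⟩⟩ | ⟨⟨f⟩⟩ <;>
    simp only [IsExceptional, show Nonempty _ from ⟨f.comp e⟩, true_or, or_true]

instance : DecidableRel cycleSq7PlusE.Adj := by unfold cycleSq7PlusE; infer_instance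

instance : DecidableRel Gamma1.Adj := by unfold Gamma1; infer_instance

instance (n : ℕ) : DecidableRel (doubleWheelPlus n).Adj := fun a b =>
  @instDecidableAnd _ _ _ <| by
    rcases a with a | a <;> rcases b with b | b <;> dsimp only <;> infer_instance

instance : DecidableRel K43_30.Adj := fun a b =>
  @instDecidableAnd _ _ _ <| by
    rcases a with a | a <;> rcases b with b | b <;> dsimp only <;> infer_instance

instance : DecidableRel K43_31.Adj := fun a b =>
  @instDecidableAnd _ _ _ <| by
    rcases a with a | a <;> rcases b with b | b <;> dsimp only <;> infer_instance

instance : DecidableRel K43_40.Adj := fun a b =>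
  @instDecidableAnd _ _ _ <| by
    rcases a with a | a <;> rcases b with b | b <;> dsimp only <;> infer_instance

instance : DecidableRel K43_41.Adj := fun a b =>
  @instDecidableAnd _ _ _ <| by
    rcases a with a | a <;> rcases b with b | b <;> dsimp only <;> infer_instance

theorem wheel_six_isContained {V : Type*} {G : SimpleGraph V} (h : V) (c : Fin 6 → V)
    (hc : Function.Injective c) (hub : ∀ i, G.Adj h (c i)) (rim : ∀ i, G.Adj (c i) (c (i + 1))) :
    wheel 6 ⊑ G :=
  wheel_isContained h c hc hub rim

/-- The graph contains `W₆` or is one of the six exceptional splits of `DW⁺₄`. -/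
def WheelOrExceptional {V : Type*} (G : SimpleGraph V) : Prop :=
  wheel 6 ⊑ G ∨ IsExceptional G

theorem WheelOrExceptional.congr {V W : Type*} {G : SimpleGraph V} {H : SimpleGraph W}
    (e : G ≃g H) (h : WheelOrExceptional H) : WheelOrExceptional G :=
  h.imp (fun h => h.trans e.symm.isContained) (fun h => h.congr e)

section Hub

/-- If both new vertices are adjacent to the other hub, that hub is the centre of a wheel. -/
theorem wheel_isContained_split_hub_of_mem_both {k l : Fin 2} (hlk : l ≠ k)
    {X Y : Set (ZMod 4 ⊕ Fin 2)} (hX : .inr l ∈ X) (hY : .inr l ∈ Y) {i : ZMod 4}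
    (hi : .inl i ∈ X) (hi' : .inl (i + 1) ∈ Y) :
    wheel 6 ⊑ splitGraph (doubleWheelPlus 4) (.inr k) X Y := by
  refine wheel_six_isContained (.inl ⟨.inr l, by simpa⟩)
    ![.inr 0, .inl ⟨.inl i, by simp⟩, .inl ⟨.inl (i + 3), by simp⟩, .inl ⟨.inl (i + 2), by simp⟩,
      .inl ⟨.inl (i + 1), by simp⟩, .inr 1] ?_ (fun j => ?_) (fun j => ?_)
  · clear hi hi' hX hY X Y hlk l; decide +revert
  · fin_cases j <;> simp [*, doubleWheelPlus]
  · fin_cases j <;> simp [*, doubleWheelPlus]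
    all_goals clear hi hi' hX hY X Y hlk l; decide +revert

/-- If one new vertex is adjacent to every other vertex, it is the centre of a wheel. -/
theorem wheel_isContained_split_hub_of_forall_mem {k l : Fin 2} (hlk : l ≠ k)
    {X Y : Set (ZMod 4 ⊕ Fin 2)} (hX : ∀ u ≠ .inr k, u ∈ X) {i : ZMod 4}
    (hi : .inl i ∈ Y) (hi' : .inl (i + 1) ∈ Y) :
    wheel 6 ⊑ splitGraph (doubleWheelPlus 4) (.inr k) X Y := by
  refine wheel_six_isContained (.inr 0)
    ![.inr 1, .inl ⟨.inl i, by simp⟩, .inl ⟨.inr l, by simpa⟩, .inl ⟨.inl (i + 3), by simp⟩,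
      .inl ⟨.inl (i + 2), by simp⟩, .inl ⟨.inl (i + 1), by simp⟩] ?_ (fun j => ?_) (fun j => ?_)
  · clear hi hi' hX X Y; decide +revert
  · fin_cases j <;> simp [*]
  · fin_cases j <;> simp [*, doubleWheelPlus]
    all_goals clear hi hi' hX X Y hlk l; decide +revert

/-- The relabelling of a split of a hub of `DW⁺₄` sending the rim, read from `m`, to `r`, the other
hub to `w`, and the two new vertices to `x` and `y`. -/
def relabelHubSplit {α : Type*} (k : Fin 2) (m : ZMod 4) (r : ZMod 4 → α) (w x y : α) :
    {u : ZMod 4 ⊕ Fin 2 // u ≠ .inr k} ⊕ Fin 2 → α :=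
  Sum.elim (fun u => Sum.elim (fun j => r (j - m)) (fun _ => w) u.1) ![x, y]

theorem isExceptional_split_hub_univ (k : Fin 2) (m : ZMod 4) {T : Finset (ZMod 4)}
    (h : T = {m, m + 1} ∨ T = {m, m + 2} ∨ T = {m, m + 1, m + 2}) :
    IsExceptional (splitGraph (doubleWheelPlus 4) (.inr k)
      ↑((Finset.univ : Finset (ZMod 4)).disjSum (∅ : Finset (Fin 2))) ↑(T.disjSum {k + 1})) := by
  rcases h with rfl | rfl | rfl
  · exact .inr <| .inr <| .inr <| .inr <| .inl <| nonempty_iso_of_injective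
      (relabelHubSplit k m ![5, 6, 1, 0] 2 4 3)
      (by decide +revert +kernel) (by decide +revert +kernel) (by decide +revert +kernel)
  · exact .inr <| .inr <| .inr <| .inl <| nonempty_iso_of_injective
      (relabelHubSplit k m ![.inl 0, .inr 0, .inl 2, .inr 1] (.inl 1) (.inl 3) (.inr 2))
      (by decide +revert +kernel) (by decide +revert +kernel) (by decide +revert +kernel)
  · exact .inr <| .inr <| .inr <| .inr <| .inr <| nonempty_iso_of_injective
      (relabelHubSplit k m ![.inl 0, .inr 0, .inl 2, .inr 2] (.inl 1) (.inl 3) (.inr 1))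
      (by decide +revert +kernel) (by decide +revert +kernel) (by decide +revert +kernel)

theorem isExceptional_split_hub_three (k : Fin 2) (m : ZMod 4) {T : Finset (ZMod 4)}
    (h : T = {m, m + 3} ∨ T = {m, m + 1} ∨ T = {m, m + 2} ∨ T = {m, m + 2, m + 3} ∨
      T = {m, m + 1, m + 2} ∨ T = {m, m + 1, m + 3}) :
    IsExceptional (splitGraph (doubleWheelPlus 4) (.inr k)
      ↑(Finset.disjSum {m + 1, m + 2, m + 3} (∅ : Finset (Fin 2))) ↑(T.disjSum {k + 1})) := by
  rcases h with rfl | rfl | rfl | rfl | rfl | rfl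
  · exact .inl <| nonempty_iso_of_injective (relabelHubSplit k m ![1, 6, 5, 3] 0 4 2)
      (by decide +revert +kernel) (by decide +revert +kernel) (by decide +revert +kernel)
  · exact .inl <| nonempty_iso_of_injective (relabelHubSplit k m ![1, 3, 5, 6] 0 4 2)
      (by decide +revert +kernel) (by decide +revert +kernel) (by decide +revert +kernel)
  · exact .inr <| .inl <| nonempty_iso_of_injective
      (relabelHubSplit k m ![.inl 0, .inr 0, .inl 2, .inr 1] (.inl 1) (.inl 3) (.inr 2))
      (by decide +revert +kernel) (by decide +revert +kernel) (by decide +revert +kernel)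
  · exact .inr <| .inr <| .inl <| nonempty_iso_of_injective
      (relabelHubSplit k m ![.inl 0, .inr 2, .inl 2, .inr 0] (.inl 1) (.inl 3) (.inr 1))
      (by decide +revert +kernel) (by decide +revert +kernel) (by decide +revert +kernel)
  · exact .inr <| .inr <| .inl <| nonempty_iso_of_injective
      (relabelHubSplit k m ![.inl 0, .inr 0, .inl 2, .inr 2] (.inl 1) (.inl 3) (.inr 1))
      (by decide +revert +kernel) (by decide +revert +kernel) (by decide +revert +kernel)
  · exact .inr <| .inr <| .inr <| .inr <| .inl <| nonempty_iso_of_injective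
      (relabelHubSplit k m ![3, 2, 0, 4] 5 1 6)
      (by decide +revert +kernel) (by decide +revert +kernel) (by decide +revert +kernel)

theorem exists_mem_add_one_mem : ∀ S T : Finset (ZMod 4), S ∪ T = .univ → 2 ≤ S.card →
    2 ≤ T.card → ∃ i, i ∈ S ∧ i + 1 ∈ T := by
  decide +kernel

theorem exists_eq_of_union_eq_univ : ∀ S T : Finset (ZMod 4), S ∪ T = .univ → 3 ≤ S.card →
    2 ≤ T.card → T ≠ .univ → ∃ m,
      (S = .univ ∧ (T = {m, m + 1} ∨ T = {m, m + 2} ∨ T = {m, m + 1, m + 2})) ∨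
      (S = {m + 1, m + 2, m + 3} ∧ (T = {m, m + 3} ∨ T = {m, m + 1} ∨ T = {m, m + 2} ∨
        T = {m, m + 2, m + 3} ∨ T = {m, m + 1, m + 2} ∨ T = {m, m + 1, m + 3})) := by
  decide +kernel

theorem split_hub_of_notMem (k : Fin 2) {S T : Finset (ZMod 4)} (hST : S ∪ T = .univ)
    (hS : 3 ≤ S.card) (hT : 2 ≤ T.card) :
    WheelOrExceptional (splitGraph (doubleWheelPlus 4) (.inr k)
      ↑(S.disjSum (∅ : Finset (Fin 2))) ↑(T.disjSum {k + 1})) := by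
  by_cases hT' : T = .univ
  · subst hT'
    obtain ⟨i, hi, hi'⟩ : ∃ i, i ∈ S ∧ i + 1 ∈ S := by clear k hST hT; decide +revert
    refine .congr (splitGraphSwap ..) <| .inl <|
      wheel_isContained_split_hub_of_forall_mem (l := k + 1) (i := i) ?_ ?_ ?_ ?_
    · decide +revert
    · clear hi hi' i hST hS hT S; decide +revert
    · simpa
    · simpa
  · right
    obtain ⟨m, ⟨rfl, h⟩ | ⟨rfl, h⟩⟩ := exists_eq_of_union_eq_univ S T hST hS hT hT'
    · exact isExceptional_split_hub_univ k m h
    · exact isExceptional_split_hub_three k m h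

theorem wheelOrExceptional_split_hub (k : Fin 2) {S T : Finset (ZMod 4)} {R Q : Finset (Fin 2)}
    (hST : S ∪ T = .univ) (hRQ : R ∪ Q = {k + 1}) (hX : 3 ≤ S.card + R.card)
    (hY : 3 ≤ T.card + Q.card) :
    WheelOrExceptional (splitGraph (doubleWheelPlus 4) (.inr k)
      ↑(S.disjSum R) ↑(T.disjSum Q)) := by
  have hcases : R = {k + 1} ∧ Q = {k + 1} ∨ R = ∅ ∧ Q = {k + 1} ∨ R = {k + 1} ∧ Q = ∅ := by
    clear hX hY hST; decide +revert
  obtain ⟨rfl, rfl⟩ | ⟨rfl, rfl⟩ | ⟨rfl, rfl⟩ := hcases <;>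
    simp only [Finset.card_singleton, Finset.card_empty] at hX hY
  · obtain ⟨i, hi, hi'⟩ := exists_mem_add_one_mem S T hST (by omega) (by omega)
    exact .inl <| wheel_isContained_split_hub_of_mem_both (l := k + 1) (i := i)
      (by decide +revert) (by simp) (by simp) (by simpa) (by simpa)
  · exact split_hub_of_notMem k hST (by omega) (by omega)
  · exact (split_hub_of_notMem k (by rwa [Finset.union_comm]) (by omega) (by omega)).congr
      (splitGraphSwap ..)

end Hub

section Rim

/-- If both new vertices are adjacent to the same hub, that hub is the centre of a wheel. -/
theorem wheel_isContained_split_rim {k l : Fin 2} (hlk : l ≠ k) {X Y : Set (ZMod 4 ⊕ Fin 2)}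
    {i d : ZMod 4} (hd : d = 1 ∨ d = 3) (hX : .inr k ∈ X) (hY : .inr k ∈ Y) (hl : .inr l ∈ X)
    (hi : .inl (i + d) ∈ Y) :
    wheel 6 ⊑ splitGraph (doubleWheelPlus 4) (.inl i) X Y := by
  have h₁ : i + d ≠ i := by clear hi; decide +revert
  have h₂ : i - d ≠ i := by clear hi; decide +revert
  refine wheel_six_isContained (.inl ⟨.inr k, by simp⟩)
    ![.inr 1, .inl ⟨.inl (i + d), by simpa using h₁⟩,
      .inl ⟨.inl (i + 2), by simp; decide⟩,
      .inl ⟨.inl (i - d), by simpa using h₂⟩, .inl ⟨.inr l, by simp⟩, .inr 0]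
    ?_ (fun j => ?_) (fun j => ?_)
  · clear hi hX hY hl X Y; decide +revert
  · fin_cases j <;> simp [*, hlk.symm, doubleWheelPlus]
  · fin_cases j <;> simp [*, doubleWheelPlus]
    all_goals clear hi hX hY hl X Y hlk; decide +revert

/-- The relabelling of a split of the rim vertex `i` of `DW⁺₄` sending the rim, read from `i`, to `r`,
the hub `k` to `u`, the other hub to `w`, and the two new vertices to `x` and `y`. -/
def relabelRimSplit {α : Type*} (i : ZMod 4) (k : Fin 2) (r : ZMod 4 → α)
    (u w x y : α) : {u : ZMod 4 ⊕ Fin 2 // u ≠ .inl i} ⊕ Fin 2 → α :=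
  Sum.elim (fun v => Sum.elim (fun j => r (j - i)) (fun j => if j = k then u else w) v.1) ![x, y]

theorem nonempty_split_rim_iso_Gamma1 (i : ZMod 4) (k : Fin 2) :
    Nonempty (splitGraph (doubleWheelPlus 4) (.inl i)
      ↑(Finset.disjSum {i + 1, i + 3} ({k} : Finset (Fin 2)))
      ↑(Finset.disjSum {i + 1, i + 3} ({k + 1} : Finset (Fin 2))) ≃g Gamma1) :=
  nonempty_iso_of_injective (relabelRimSplit i k ![0, 2, 3, 4] 5 6 0 1)
    (by decide +revert +kernel) (by decide +revert +kernel) (by decide +revert +kernel)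

theorem exists_mem_inter_or_eq : ∀ R Q : Finset (Fin 2), R ∪ Q = .univ → 1 ≤ R.card →
    1 ≤ Q.card → ∃ k, (k ∈ R ∧ k ∈ Q) ∨ (R = {k} ∧ Q = {k + 1}) := by
  decide

theorem wheelOrExceptional_split_rim (i : ZMod 4) {S T : Finset (ZMod 4)} {R Q : Finset (Fin 2)}
    (hST : S ∪ T = {i + 1, i + 3}) (hRQ : R ∪ Q = .univ) (hX : 3 ≤ S.card + R.card)
    (hY : 3 ≤ T.card + Q.card) :
    WheelOrExceptional (splitGraph (doubleWheelPlus 4) (.inl i)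
      ↑(S.disjSum R) ↑(T.disjSum Q)) := by
  have hS : S ⊆ {i + 1, i + 3} := hST ▸ Finset.subset_union_left
  have hT : T ⊆ {i + 1, i + 3} := hST ▸ Finset.subset_union_right
  have hS' := (Finset.card_le_card hS).trans Finset.card_le_two
  have hT' := (Finset.card_le_card hT).trans Finset.card_le_two
  have hR' : R.card ≤ 2 := R.card_le_univ
  have hQ' : Q.card ≤ 2 := Q.card_le_univ
  obtain ⟨k, ⟨hkR, hkQ⟩ | ⟨rfl, rfl⟩⟩ := exists_mem_inter_or_eq R Q hRQ (by omega) (by omega)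
  · have hne : k + 1 ≠ k := (by decide : ∀ k : Fin 2, k + 1 ≠ k) k
    have hmem : ∀ U ⊆ ({i + 1, i + 3} : Finset (ZMod 4)), 1 ≤ U.card →
        ∃ d : ZMod 4, (d = 1 ∨ d = 3) ∧ i + d ∈ U := fun U hU hU' => by
      obtain ⟨j, hj⟩ := Finset.card_pos.1 hU'
      rcases Finset.mem_insert.1 (hU hj) with rfl | h
      · exact ⟨1, .inl rfl, hj⟩
      · exact ⟨3, .inr rfl, Finset.mem_singleton.1 h ▸ hj⟩
    rcases Finset.mem_union.1 (hRQ ▸ Finset.mem_univ (k + 1)) with hl | hl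
    · obtain ⟨d, hd, hdT⟩ := hmem T hT (by omega)
      exact .inl <| wheel_isContained_split_rim hne hd (by simpa) (by simpa) (by simpa) (by simpa)
    · obtain ⟨d, hd, hdS⟩ := hmem S hS (by omega)
      exact .congr (splitGraphSwap ..) <| .inl <|
        wheel_isContained_split_rim hne hd (by simpa) (by simpa) (by simpa) (by simpa)
  · simp only [Finset.card_singleton] at hX hY
    obtain rfl := Finset.eq_of_subset_of_card_le hS (Finset.card_le_two.trans (by omega))
    obtain rfl := Finset.eq_of_subset_of_card_le hT (Finset.card_le_two.trans (by omega))
    exact .inr <| .inr <| .inr <| .inr <| .inr <| .inl <| nonempty_split_rim_iso_Gamma1 i k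

end Rim

theorem wheelOrExceptional_of_isSplitData {v : ZMod 4 ⊕ Fin 2} {X Y : Set (ZMod 4 ⊕ Fin 2)}
    (h : IsSplitData (doubleWheelPlus 4) v X Y) :
    WheelOrExceptional (splitGraph (doubleWheelPlus 4) v X Y) := by
  obtain ⟨X, rfl⟩ := X.toFinite.exists_finset_coe
  obtain ⟨Y, rfl⟩ := Y.toFinite.exists_finset_coe
  obtain ⟨-, -, hXY, hX, hY⟩ := h
  rw [Set.ncard_coe_finset, ← Finset.card_toLeft_add_card_toRight] at hX hY
  rw [← X.toLeft_disjSum_toRight, ← Y.toLeft_disjSum_toRight]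
  have hN : X ∪ Y = (doubleWheelPlus 4).neighborFinset v := by
    rw [← Finset.coe_inj]; simpa using hXY
  have hL := congrArg Finset.toLeft hN
  have hR := congrArg Finset.toRight hN
  rw [Finset.toLeft_union] at hL
  rw [Finset.toRight_union] at hR
  rcases v with i | k
  · refine wheelOrExceptional_split_rim i (hL.trans ?_) (hR.trans ?_) hX hY <;>
      clear hL hR hN hX hY hXY X Y <;> decide +revert
  · refine wheelOrExceptional_split_hub k (hL.trans ?_) (hR.trans ?_) hX hY <;>
      clear hL hR hN hX hY hXY X Y <;> decide +revert

theorem IsExceptional.not_wheel_isMinorOf {V : Type*} {G : SimpleGraph V} (h : IsExceptional G) :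
    ¬ (wheel 6).IsMinorOf G := by
  have key : ∀ {W : Type} [Fintype W] {H : SimpleGraph W}, Fintype.card W = 7 →
      (∀ v, ∃ u ≠ v, ¬ H.Adj v u) → Nonempty (G ≃g H) → ¬ (wheel 6).IsMinorOf G := by
    rintro W _ H hcard hH ⟨e⟩ hG
    have := Fintype.ofEquiv W e.toEquiv.symm
    obtain ⟨v, hv⟩ := exists_dominating_of_wheel_isMinorOf
      ((Fintype.card_congr e.toEquiv).trans hcard) hG
    obtain ⟨u, hu, huv⟩ := hH (e v)
    refine huv ?_
    have := hv (e.symm u) fun h => hu (by simp [← h])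
    simpa using e.map_adj_iff.2 this
  rcases h with h | h | h | h | h | h <;> exact key rfl (by decide) h

theorem stmt17 (v : ZMod 4 ⊕ Fin 2) (X Y : Set (ZMod 4 ⊕ Fin 2))
    (h : IsSplitData (doubleWheelPlus 4) v X Y) :
    ¬ (wheel 6).IsMinorOf (splitGraph (doubleWheelPlus 4) v X Y) ↔
      (Nonempty (splitGraph (doubleWheelPlus 4) v X Y ≃g cycleSq7PlusE) ∨
        Nonempty (splitGraph (doubleWheelPlus 4) v X Y ≃g K43_30) ∨
        Nonempty (splitGraph (doubleWheelPlus 4) v X Y ≃g K43_31) ∨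
        Nonempty (splitGraph (doubleWheelPlus 4) v X Y ≃g K43_40) ∨
        Nonempty (splitGraph (doubleWheelPlus 4) v X Y ≃g Gamma1) ∨
        Nonempty (splitGraph (doubleWheelPlus 4) v X Y ≃g K43_41)) := by
  constructor
  · exact fun hG => (wheelOrExceptional_of_isSplitData h).resolve_left fun hW => hG hW.isMinorOf
  · exact IsExceptional.not_wheel_isMinorOf
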